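/- Let x be a solution of the opinion dynamics, and let I ⊆ I' be closed intervals with I contained in the interior of I' and ∫_0^∞ μ_t(I') dt < ∞. Then the set {α ∈ [0,1] : the set of times {t ≥ 0 : x_t(α) ∈ I} is unbounded} is contained in a set of Lebesgue measure zero. -/

import Mathlib

open MeasureTheory Filter Set Topology

/-- The interaction field at time `t` for agent `α`:
`∫_0^1 w(t,α,β,x_t(α),x_t(β)) · (x_t(β) − x_t(α)) dβ`. -/
noncomputable def interactionField (w : ℝ → ℝ → ℝ → ℝ → ℝ → ℝ) (x : ℝ → ℝ → ℝ)
    (t α : ℝ) : ℝ :=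
  ∫ β in (0:ℝ)..1, w t α β (x t α) (x t β) * (x t β - x t α)

/-- `f` is absolutely continuous on the compact interval `[a,b]`. -/
def AbsolutelyContinuousOn (f : ℝ → ℝ) (a b : ℝ) : Prop :=
  ∀ ε > 0, ∃ δ > 0, ∀ n : ℕ, ∀ c d : Fin n → ℝ,
    (∀ i, a ≤ c i ∧ c i ≤ d i ∧ d i ≤ b) →
    (Pairwise fun i j => Set.Ioo (c i) (d i) ∩ Set.Ioo (c j) (d j) = ∅) →
    (∑ i, (d i - c i)) < δ → (∑ i, |f (d i) - f (c i)|) < ε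

/-- `w` is an admissible weight function: jointly Borel measurable, nonnegative and
bounded by `W` on the domain `[0,∞) × [0,1] × [0,1] × ℝ × ℝ`. -/
structure IsWeight (W : ℝ) (w : ℝ → ℝ → ℝ → ℝ → ℝ → ℝ) : Prop where
  measurable : Measurable fun p : ℝ × ℝ × ℝ × ℝ × ℝ =>
    w p.1 p.2.1 p.2.2.1 p.2.2.2.1 p.2.2.2.2
  nonneg : ∀ t, 0 ≤ t → ∀ α ∈ Icc (0:ℝ) 1, ∀ β ∈ Icc (0:ℝ) 1, ∀ a b : ℝ,
    0 ≤ w t α β a b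
  le_bound : ∀ t, 0 ≤ t → ∀ α ∈ Icc (0:ℝ) 1, ∀ β ∈ Icc (0:ℝ) 1, ∀ a b : ℝ,
    w t α β a b ≤ W

/-- `x` is a solution of the opinion dynamics with weight function `w`:
measurable in the agent, absolutely continuous in time on compact intervals,
with initial opinions in `[0,1]`, locally bounded, and for each agent satisfying
the ODE `(d/dt) x_t(α) = ∫_0^1 w(t,α,β,x_t(α),x_t(β))·(x_t(β) − x_t(α)) dβ`
for almost every `t ≥ 0`. -/
structure IsSolution (w : ℝ → ℝ → ℝ → ℝ → ℝ → ℝ) (x : ℝ → ℝ → ℝ) : Prop where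
  meas : ∀ t, 0 ≤ t → Measurable (x t)
  absCont : ∀ α ∈ Icc (0:ℝ) 1, ∀ T, 0 ≤ T → AbsolutelyContinuousOn (fun t => x t α) 0 T
  init_mem : ∀ α ∈ Icc (0:ℝ) 1, x 0 α ∈ Icc (0:ℝ) 1
  locBdd : ∀ T, 0 ≤ T → ∃ M : ℝ, ∀ α ∈ Icc (0:ℝ) 1, ∀ t ∈ Icc (0:ℝ) T, |x t α| ≤ M
  ode : ∀ α ∈ Icc (0:ℝ) 1, ∀ᵐ t ∂(volume.restrict (Ici (0:ℝ))),
    HasDerivAt (fun s => x s α) (interactionField w x t α) t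

/-- The weight function is symmetric. -/
def SymmetricWeight (w : ℝ → ℝ → ℝ → ℝ → ℝ → ℝ) : Prop :=
  ∀ t α β a b, w t α β a b = w t β α b a

/-- `w ∈ Γ(r,Δ)`: the weight is at least `Δ` whenever the two opinions are within `r`. -/
def InGamma (r Δ : ℝ) (w : ℝ → ℝ → ℝ → ℝ → ℝ → ℝ) : Prop :=
  ∀ t, 0 ≤ t → ∀ α ∈ Icc (0:ℝ) 1, ∀ β ∈ Icc (0:ℝ) 1, ∀ a b : ℝ,
    |a - b| ≤ r → Δ ≤ w t α β a b

/-- The opinion distribution `μ_t`: pushforward of Lebesgue measure on `[0,1]` by `x_t`. -/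
noncomputable def opinionMeasure (x : ℝ → ℝ → ℝ) (t : ℝ) : Measure ℝ :=
  (volume.restrict (Icc (0:ℝ) 1)).map (x t)

/-- The order of the opinions is preserved: if agent `β`'s opinion is strictly above
agent `α`'s at some time, it is strictly above at every time. -/
def OrderPreserved (x : ℝ → ℝ → ℝ) : Prop :=
  ∀ α ∈ Icc (0:ℝ) 1, ∀ β ∈ Icc (0:ℝ) 1, ∀ s, 0 ≤ s → ∀ t, 0 ≤ t →
    x t α < x t β → x s α < x s β

theorem AbsolutelyContinuousOn.absolutelyContinuousOnInterval {f : ℝ → ℝ} {a b : ℝ}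
    (hab : a ≤ b) (hf : AbsolutelyContinuousOn f a b) :
    AbsolutelyContinuousOnInterval f a b := by
  rw [absolutelyContinuousOnInterval_iff]
  intro ε hε
  obtain ⟨δ, hδ, h⟩ := hf ε hε
  refine ⟨δ, hδ, ?_⟩
  rintro ⟨n, I⟩ ⟨hmem, hdisj⟩ hlen
  simp only [Finset.mem_range, uIcc_of_le hab] at hmem hlen ⊢
  have key := h n (fun i => min (I i).1 (I i).2) (fun i => max (I i).1 (I i).2) ?_ ?_ ?_
  · rw [Finset.sum_range]
    refine lt_of_le_of_lt (Finset.sum_le_sum fun i _ => ?_) key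
    rcases le_total (I i).1 (I i).2 with hi | hi <;>
      simp [hi, Real.dist_eq, abs_sub_comm]
  · intro i
    obtain ⟨h1, h2⟩ := hmem i i.2
    exact ⟨le_min h1.1 h2.1, min_le_max, max_le h1.2 h2.2⟩
  · intro i j hij
    rw [← Set.disjoint_iff_inter_eq_empty]
    have hd := hdisj (Finset.mem_coe.2 (Finset.mem_range.2 i.2))
      (Finset.mem_coe.2 (Finset.mem_range.2 j.2)) (Fin.val_ne_of_ne hij)
    exact hd.mono Ioo_subset_Ioc_self Ioo_subset_Ioc_self
  · refine lt_of_eq_of_lt ?_ hlen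
    rw [Finset.sum_range]
    refine Finset.sum_congr rfl fun i _ => ?_
    simp [Real.dist_eq, max_sub_min_eq_abs, abs_sub_comm]

/-- An absolutely continuous function with almost everywhere nonnegative derivative increases. -/
theorem AbsolutelyContinuousOnInterval.le_of_ae_hasDerivAt_nonneg {f f' : ℝ → ℝ} {a b : ℝ}
    (hab : a ≤ b) (hf : AbsolutelyContinuousOnInterval f a b)
    (hf' : ∀ᵐ t ∂volume.restrict (Icc a b), HasDerivAt f (f' t) t ∧ 0 ≤ f' t) :
    f a ≤ f b := by
  rw [← sub_nonneg, ← hf.integral_deriv_eq_sub]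
  refine intervalIntegral.integral_nonneg_of_ae_restrict hab ?_
  filter_upwards [hf'] with t ht
  simpa [ht.1.deriv] using ht.2

/-- Comparison principle for families of absolutely continuous functions
whose growth rate is at most `W` times the distance to any common upper bound. -/
theorem le_of_ae_deriv_le_mul_sub {ι : Type*} {y F : ℝ → ι → ℝ} {T W M c : ℝ}
    (hac : ∀ i, AbsolutelyContinuousOnInterval (fun t => y t i) 0 T)
    (hderiv : ∀ i, ∀ᵐ t ∂volume.restrict (Icc 0 T), HasDerivAt (fun s => y s i) (F t i) t)
    (hinit : ∀ i, y 0 i ≤ c) (hM : ∀ i, ∀ t ∈ Icc 0 T, y t i ≤ M)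
    (hW : 0 ≤ W)
    (hF : ∀ m, ∀ t ∈ Icc 0 T, (∀ i, y t i ≤ m) → ∀ i, F t i ≤ W * (m - y t i)) :
    ∀ i, ∀ t ∈ Icc 0 T, y t i ≤ c := by
  set k : ℝ := 1 - Real.exp (-(W * T)) with hk
  have step : ∀ m, c ≤ m → (∀ i, ∀ t ∈ Icc 0 T, y t i ≤ m) →
      ∀ i, ∀ t ∈ Icc 0 T, y t i ≤ c + k * (m - c) := by
    intro m hcm hm i t ht
    have hsub : uIcc 0 t ⊆ uIcc 0 T := by
      rw [uIcc_of_le ht.1, uIcc_of_le (ht.1.trans ht.2)]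
      exact Icc_subset_Icc_right ht.2
    have hexp : AbsolutelyContinuousOnInterval (fun s => Real.exp (W * s)) 0 t :=
      ContDiffOn.absolutelyContinuousOnInterval (by fun_prop)
    have hconst : AbsolutelyContinuousOnInterval (fun _ : ℝ => m) 0 t :=
      ContDiffOn.absolutelyContinuousOnInterval (by fun_prop)
    have hmono := (hexp.fun_mul (hconst.fun_sub ((hac i).mono hsub))).le_of_ae_hasDerivAt_nonneg
      (f' := fun s => Real.exp (W * s) * W * (m - y s i) + Real.exp (W * s) * (0 - F s i)) ht.1 (by
        filter_upwards [ae_restrict_of_ae_restrict_of_subset (Icc_subset_Icc_right ht.2) (hderiv i),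
          ae_restrict_mem measurableSet_Icc] with s hs hs'
        refine ⟨?_, ?_⟩
        · have h1 : HasDerivAt (fun s => Real.exp (W * s)) (Real.exp (W * s) * W) s := by
            simpa using ((hasDerivAt_id s).const_mul W).exp
          exact h1.mul ((hasDerivAt_const s m).sub hs)
        · have h2 := hF m s ⟨hs'.1, hs'.2.trans ht.2⟩
            (fun j => hm j s ⟨hs'.1, hs'.2.trans ht.2⟩) i
          have h3 := mul_nonneg (Real.exp_pos (W * s)).le (sub_nonneg.2 h2)
          linarith)
    simp only [mul_zero, Real.exp_zero, one_mul] at hmono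
    have h4 : m - c ≤ Real.exp (W * t) * (m - y t i) := by linarith [hinit i]
    have h5 : Real.exp (W * t) * (m - y t i) ≤ Real.exp (W * T) * (m - y t i) :=
      mul_le_mul_of_nonneg_right (Real.exp_le_exp.2 (mul_le_mul_of_nonneg_left ht.2 hW))
        (sub_nonneg.2 (hm i t ht))
    have h6 : Real.exp (-(W * T)) * (m - c) ≤ m - y t i := by
      rw [Real.exp_neg, inv_mul_le_iff₀ (Real.exp_pos _)]
      exact h4.trans h5
    rw [hk]
    linarith
  intro i t ht
  have hT : 0 ≤ T := ht.1.trans ht.2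
  have hk0 : 0 ≤ k := sub_nonneg.2 (Real.exp_le_one_iff.2 (neg_nonpos.2 (mul_nonneg hW hT)))
  have hk1 : k < 1 := sub_lt_self _ (Real.exp_pos _)
  have hiter : ∀ n : ℕ, ∀ i, ∀ t ∈ Icc 0 T, y t i ≤ c + k ^ n * (max M c - c) := by
    intro n
    induction n with
    | zero => intro i t ht; simpa using Or.inl (hM i t ht)
    | succ n ih =>
      intro i t ht
      have hnn : 0 ≤ k ^ n * (max M c - c) :=
        mul_nonneg (pow_nonneg hk0 n) (sub_nonneg.2 (le_max_right _ _))
      refine (step _ (le_add_of_nonneg_right hnn) ih i t ht).trans_eq ?_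
      ring
  have hlim : Tendsto (fun n : ℕ => c + k ^ n * (max M c - c)) atTop (𝓝 c) := by
    simpa using ((tendsto_pow_atTop_nhds_zero_of_lt_one hk0 hk1).mul_const (max M c - c)).const_add c
  exact ge_of_tendsto' hlim fun n => hiter n i t ht

theorem integral_mul_sub_le {v z : ℝ → ℝ} {W m z₀ : ℝ}
    (hv : ∀ β ∈ Icc (0:ℝ) 1, 0 ≤ v β) (hvW : ∀ β ∈ Icc (0:ℝ) 1, v β ≤ W)
    (hz : ∀ β ∈ Icc (0:ℝ) 1, z β ≤ m) (hz₀ : z₀ ≤ m) :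
    ∫ β in (0:ℝ)..1, v β * (z β - z₀) ≤ W * (m - z₀) := by
  have hW : 0 ≤ W := (hv 0 (by simp)).trans (hvW 0 (by simp))
  by_cases hi : IntervalIntegrable (fun β => v β * (z β - z₀)) volume 0 1
  · refine (intervalIntegral.integral_mono_on zero_le_one hi
      (intervalIntegrable_const (c := W * (m - z₀))) fun β hβ => ?_).trans_eq (by simp)
    exact (mul_le_mul_of_nonneg_left (sub_le_sub_right (hz β hβ) z₀) (hv β hβ)).trans
      (mul_le_mul_of_nonneg_right (hvW β hβ) (sub_nonneg.2 hz₀))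
  · rw [intervalIntegral.integral_undef hi]
    exact mul_nonneg hW (sub_nonneg.2 hz₀)

section Solution

variable {W : ℝ} {w : ℝ → ℝ → ℝ → ℝ → ℝ → ℝ} {x : ℝ → ℝ → ℝ}

theorem IsWeight.interactionField_le (hw : IsWeight W w) {t α m : ℝ} (ht : 0 ≤ t)
    (hα : α ∈ Icc (0:ℝ) 1) (hm : ∀ β ∈ Icc (0:ℝ) 1, x t β ≤ m) :
    interactionField w x t α ≤ W * (m - x t α) :=
  integral_mul_sub_le (fun β hβ => hw.nonneg t ht α hα β hβ _ _)
    (fun β hβ => hw.le_bound t ht α hα β hβ _ _) hm (hm α hα)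

theorem IsWeight.neg_interactionField_le (hw : IsWeight W w) {t α m : ℝ} (ht : 0 ≤ t)
    (hα : α ∈ Icc (0:ℝ) 1) (hm : ∀ β ∈ Icc (0:ℝ) 1, -x t β ≤ m) :
    -interactionField w x t α ≤ W * (m - -x t α) := by
  have h := integral_mul_sub_le (z := fun β => -x t β)
    (fun β hβ => hw.nonneg t ht α hα β hβ (x t α) (x t β))
    (fun β hβ => hw.le_bound t ht α hα β hβ _ _) hm (hm α hα)
  rw [interactionField, ← intervalIntegral.integral_neg]
  convert h using 3
  ring

theorem IsSolution.absolutelyContinuousOnInterval (hx : IsSolution w x) {α s t : ℝ}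
    (hα : α ∈ Icc (0:ℝ) 1) (hs : 0 ≤ s) (ht : 0 ≤ t) :
    AbsolutelyContinuousOnInterval (fun t => x t α) s t := by
  have hm : 0 ≤ max s t := le_max_of_le_left hs
  refine ((hx.absCont α hα _ hm).absolutelyContinuousOnInterval hm).mono ?_
  rw [uIcc_of_le hm]
  exact Icc_subset_Icc (le_min hs ht) le_rfl

theorem IsSolution.mem_Icc (hw : IsWeight W w) (hx : IsSolution w x) (hW : 0 ≤ W) {t α : ℝ}
    (ht : 0 ≤ t) (hα : α ∈ Icc (0:ℝ) 1) : x t α ∈ Icc (0:ℝ) 1 := by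
  obtain ⟨M, hM⟩ := hx.locBdd t ht
  have hode : ∀ i : Icc (0:ℝ) 1, ∀ᵐ s ∂volume.restrict (Icc 0 t),
      HasDerivAt (fun s => x s i) (interactionField w x s i) s := fun i =>
    ae_restrict_of_ae_restrict_of_subset Icc_subset_Ici_self (hx.ode i i.2)
  constructor
  · refine neg_nonpos.1 (le_of_ae_deriv_le_mul_sub (y := fun s (i : Icc (0:ℝ) 1) => -x s i)
      (F := fun s i => -interactionField w x s i) (T := t) (W := W) (M := M)
      (fun i => (hx.absolutelyContinuousOnInterval i.2 le_rfl ht).fun_neg)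
      (fun i => (hode i).mono fun s hs => hs.neg)
      (fun i => neg_nonpos.2 (hx.init_mem i i.2).1)
      (fun i s hs => (neg_le_abs _).trans (hM i i.2 s hs)) hW
      (fun m s hs hm i => hw.neg_interactionField_le hs.1 i.2 fun β hβ => hm ⟨β, hβ⟩)
      ⟨α, hα⟩ t ⟨ht, le_rfl⟩)
  · exact le_of_ae_deriv_le_mul_sub (y := fun s (i : Icc (0:ℝ) 1) => x s i)
      (F := fun s i => interactionField w x s i) (T := t) (W := W) (M := M)
      (fun i => hx.absolutelyContinuousOnInterval i.2 le_rfl ht) hode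
      (fun i => (hx.init_mem i i.2).2)
      (fun i s hs => (le_abs_self _).trans (hM i i.2 s hs)) hW
      (fun m s hs hm i => hw.interactionField_le hs.1 i.2 fun β hβ => hm ⟨β, hβ⟩)
      ⟨α, hα⟩ t ⟨ht, le_rfl⟩

theorem IsSolution.abs_interactionField_le (hw : IsWeight W w) (hx : IsSolution w x) (hW : 0 ≤ W)
    {t α : ℝ} (ht : 0 ≤ t) (hα : α ∈ Icc (0:ℝ) 1) : |interactionField w x t α| ≤ W := by
  have hmem := hx.mem_Icc hw hW ht hα
  have h1 := hw.interactionField_le ht hα fun β hβ => (hx.mem_Icc hw hW ht hβ).2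
  have h2 := hw.neg_interactionField_le ht hα fun β hβ =>
    neg_nonpos.2 (hx.mem_Icc hw hW ht hβ).1
  rw [abs_le]
  constructor <;> nlinarith [hmem.1, hmem.2]

theorem IsSolution.lipschitzOnWith (hw : IsWeight W w) (hx : IsSolution w x) (hW : 0 ≤ W)
    {α : ℝ} (hα : α ∈ Icc (0:ℝ) 1) :
    LipschitzOnWith W.toNNReal (fun t => x t α) (Ici 0) := by
  refine LipschitzOnWith.of_dist_le_mul fun s hs t ht => ?_
  rw [Real.coe_toNNReal _ hW]
  wlog hst : s ≤ t generalizing s t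
  · rw [dist_comm, dist_comm s]
    exact this t ht s hs (le_of_not_ge hst)
  have hac := hx.absolutelyContinuousOnInterval hα hs ht
  have hlin : AbsolutelyContinuousOnInterval (fun u : ℝ => W * u) s t :=
    ContDiffOn.absolutelyContinuousOnInterval (by fun_prop)
  have hd : ∀ u, HasDerivAt (fun u : ℝ => W * u) W u := fun u => by
    simpa using (hasDerivAt_id u).const_mul W
  have hode : ∀ᵐ u ∂volume.restrict (Icc s t),
      HasDerivAt (fun u => x u α) (interactionField w x u α) u ∧
        |interactionField w x u α| ≤ W := by
    filter_upwards [ae_restrict_of_ae_restrict_of_subset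
      (fun u hu => le_trans hs hu.1 : Icc s t ⊆ Ici 0) (hx.ode α hα),
      ae_restrict_mem measurableSet_Icc] with u hu hu'
    exact ⟨hu, hx.abs_interactionField_le hw hW (le_trans hs hu'.1) hα⟩
  have h1 := (hlin.fun_add hac).le_of_ae_hasDerivAt_nonneg hst
    (hode.mono fun u hu => ⟨(hd u).add hu.1, by linarith [(abs_le.1 hu.2).1]⟩)
  have h2 := (hlin.fun_sub hac).le_of_ae_hasDerivAt_nonneg hst
    (hode.mono fun u hu => ⟨(hd u).sub hu.1, by linarith [(abs_le.1 hu.2).2]⟩)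
  rw [Real.dist_eq, Real.dist_eq, abs_sub_comm s t, abs_of_nonneg (sub_nonneg.2 hst), abs_le]
  constructor <;> linarith

/-- A solution, restricted to nonnegative times and agents in `[0,1]`, is jointly measurable. -/
theorem IsSolution.measurable_uncurry (hw : IsWeight W w) (hx : IsSolution w x) (hW : 0 ≤ W) :
    Measurable (Function.uncurry fun t α : ℝ => x (max t 0) (projIcc 0 1 zero_le_one α)) := by
  refine measurable_uncurry_of_continuous_of_measurable (fun α => ?_) fun t => ?_
  · exact (hx.lipschitzOnWith hw hW (projIcc 0 1 zero_le_one α).2).continuousOn.comp_continuous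
      (by fun_prop) fun t => le_max_right t 0
  · exact (hx.meas _ (le_max_right t 0)).comp
      (continuous_subtype_val.comp continuous_projIcc).measurable

end Solution

/-- A measurable set of reals containing intervals of a fixed length arbitrarily far to the right
has infinite measure. -/
theorem volume_eq_top_of_forall_exists_Icc_subset {S : Set ℝ} (hS : MeasurableSet S) {δ : ℝ}
    (hδ : 0 < δ) (h : ∀ n : ℕ, ∃ t, (n : ℝ) ≤ t ∧ Icc t (t + δ) ⊆ S) : volume S = ⊤ := by
  by_contra hfin
  have hlim := tendsto_measure_iInter_atTop (μ := volume) (s := fun n : ℕ => S ∩ Ici (n : ℝ))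
    (fun n => (hS.inter measurableSet_Ici).nullMeasurableSet)
    (fun m n hmn => inter_subset_inter_right _ (Ici_subset_Ici.2 (Nat.cast_le.2 hmn)))
    ⟨0, ne_top_of_le_ne_top hfin (measure_mono inter_subset_left)⟩
  have hempty : ⋂ n : ℕ, S ∩ Ici (n : ℝ) = ∅ := by
    refine eq_empty_of_forall_notMem fun t ht => ?_
    obtain ⟨n, hn⟩ := exists_nat_gt t
    exact absurd (mem_iInter.1 ht n).2 (not_le.2 hn)
  rw [hempty, measure_empty] at hlim
  have hle : ENNReal.ofReal δ ≤ 0 := by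
    refine ge_of_tendsto' hlim fun n => ?_
    obtain ⟨t, hnt, ht⟩ := h n
    calc ENNReal.ofReal δ = volume (Icc t (t + δ)) := by simp
      _ ≤ volume (S ∩ Ici (n : ℝ)) := measure_mono fun u hu => ⟨ht hu, hnt.trans hu.1⟩
  exact (ENNReal.ofReal_pos.2 hδ).not_ge hle

/-- Let `x` be a solution of the opinion dynamics and `I ⊆ I'` closed
intervals with `I` contained in the interior of `I'` and `∫_0^∞ μ_t(I') dt < ∞`. Then
the set of agents visiting `I` at unbounded times is contained in a Lebesgue-null set. -/
theorem agents_visiting_infinitely_often_in_null_set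
    (W : ℝ) (hW : 0 < W) (w : ℝ → ℝ → ℝ → ℝ → ℝ → ℝ) (x : ℝ → ℝ → ℝ)
    (hw : IsWeight W w) (hx : IsSolution w x)
    (a b a' b' : ℝ) (hsub : Icc a b ⊆ interior (Icc a' b'))
    (hfin : (∫⁻ t in Ici (0:ℝ), volume {α ∈ Icc (0:ℝ) 1 | x t α ∈ Icc a' b'}) < ⊤) :
    ∃ Z : Set ℝ, volume Z = 0 ∧
      {α ∈ Icc (0:ℝ) 1 | ∀ T, 0 ≤ T → ∃ t, T ≤ t ∧ x t α ∈ Icc a b} ⊆ Z := by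
  rcases lt_or_ge b a with hba | hab
  · refine ⟨∅, measure_empty, ?_⟩
    rintro α ⟨-, h⟩
    obtain ⟨t, -, ht⟩ := h 0 le_rfl
    exact absurd (ht.1.trans ht.2) (not_le.2 hba)
  rw [interior_Icc] at hsub
  have ha := (hsub (left_mem_Icc.2 hab)).1
  have hb := (hsub (right_mem_Icc.2 hab)).2
  let P : Set (ℝ × ℝ) := {p | p.2 ∈ Icc (0:ℝ) 1 ∧
    x (max p.1 0) (projIcc 0 1 zero_le_one p.2) ∈ Icc a' b'}
  have hPm : MeasurableSet P := (measurable_snd measurableSet_Icc).inter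
    (hx.measurable_uncurry hw hW.le measurableSet_Icc)
  have hmemP : ∀ t α, 0 ≤ t → ((t, α) ∈ P ↔ α ∈ Icc (0:ℝ) 1 ∧ x t α ∈ Icc a' b') := by
    intro t α ht
    refine and_congr_right fun hα => ?_
    simp only [max_eq_left ht, projIcc_of_mem zero_le_one hα]
  have hfin' : ∫⁻ α, volume.restrict (Ici (0:ℝ)) ((fun t => (t, α)) ⁻¹' P) < ⊤ := by
    rw [← Measure.prod_apply_symm hPm, Measure.prod_apply hPm]
    refine lt_of_le_of_lt (setLIntegral_mono' measurableSet_Ici fun t ht => ?_) hfin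
    exact measure_mono fun α hα => (hmemP t α ht).1 hα
  have hae := ae_lt_top (measurable_measure_prodMk_right hPm) hfin'.ne
  refine ⟨_, ae_iff.1 hae, ?_⟩
  rintro α ⟨hα, hvisit⟩
  rw [mem_ofPred_eq, not_lt, top_le_iff,
    Measure.restrict_apply (measurable_prodMk_right hPm)]
  set ε := min (a - a') (b' - b)
  have hε0 : 0 < ε := lt_min (sub_pos.2 ha) (sub_pos.2 hb)
  refine volume_eq_top_of_forall_exists_Icc_subset
    ((measurable_prodMk_right hPm).inter measurableSet_Ici) (div_pos hε0 hW) fun n => ?_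
  obtain ⟨t, hnt, ht⟩ := hvisit n n.cast_nonneg
  have ht0 : 0 ≤ t := n.cast_nonneg.trans hnt
  refine ⟨t, hnt, fun u hu => ?_⟩
  have hu0 : 0 ≤ u := ht0.trans hu.1
  refine ⟨(hmemP u α hu0).2 ⟨hα, ?_⟩, hu0⟩
  have hdist := (hx.lipschitzOnWith hw hW.le hα).dist_le_mul u hu0 t ht0
  rw [Real.coe_toNNReal _ hW.le, Real.dist_eq, Real.dist_eq,
    abs_of_nonneg (sub_nonneg.2 hu.1)] at hdist
  have hWε : W * (u - t) ≤ ε := by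
    rw [← le_div_iff₀' hW]
    linarith [hu.2]
  obtain ⟨h1, h2⟩ := abs_le.1 (hdist.trans hWε)
  have h3 : ε ≤ a - a' := min_le_left _ _
  have h4 : ε ≤ b' - b := min_le_right _ _
  exact ⟨by linarith [ht.1], by linarith [ht.2]⟩
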